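/- arXiv:math/0502314 — 2 statements merged into one kernel-verified Lean document; each statement's English description precedes it below -/
import Mathlib

section
/- Linear algebra lemma: Let K be a field, let E and F be finite-dimensional K-vector spaces, let B : E → F be a linear transformation, and let r = dim Im B. Define the linear map ad^r B : F → Hom_K(Λ^r E, Λ^{r+1} F) by (ad^r B)(ω)(η_1 ∧ ⋯ ∧ η_r) = ω ∧ Bη_1 ∧ ⋯ ∧ Bη_r (with ad^0 B = id_F). Then Im B = Ker(ad^r B). -/
open ExteriorAlgebra

theorem wedge_ne_zero_of_linearIndependent {K F : Type*} [Field K] [AddCommGroup F] [Module K F]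
    {n : ℕ} {v : Fin n → F} (hv : LinearIndependent K v) : ExteriorAlgebra.ιMulti K n v ≠ 0 := by
  intro h
  have h1 := (exteriorPower.ιMulti_family_linearIndependent_field (n := n) hv).ne_zero
    (Set.powersetCard.ofFinEmbEquiv (RelEmbedding.refl (· ≤ ·)))
  apply h1
  apply Subtype.ext
  rw [exteriorPower.ιMulti_family, Equiv.symm_apply_apply]
  exact h

/-- Linear algebra lemma: if `B : E → F` is linear with `r = dim Im B`, then
`Im B = Ker (ad^r B)`, where `(ad^r B)(ω)(η₁ ∧ ⋯ ∧ η_r) = ω ∧ Bη₁ ∧ ⋯ ∧ Bη_r`.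
Membership in `Ker (ad^r B)` is expressed by the vanishing of all the wedge
products `ω ∧ Bη₁ ∧ ⋯ ∧ Bη_r` (which generate the image of `(ad^r B)(ω)`). -/
theorem image_eq_ker_ad
    (K E F : Type*) [Field K]
    [AddCommGroup E] [Module K E] [AddCommGroup F] [Module K F]
    [FiniteDimensional K E] [FiniteDimensional K F]
    (B : E →ₗ[K] F) (r : ℕ) (hr : r = Module.finrank K (LinearMap.range B)) :
    ∀ ω : F, ω ∈ LinearMap.range B ↔
      ∀ η : Fin r → E,
        ExteriorAlgebra.ι K ω *
          (List.ofFn fun i : Fin r => ExteriorAlgebra.ι K (B (η i))).prod = 0 := by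
  intro ω
  have key : ∀ η : Fin r → E, ExteriorAlgebra.ι K ω *
      (List.ofFn fun i : Fin r => ExteriorAlgebra.ι K (B (η i))).prod =
      ExteriorAlgebra.ιMulti K (r + 1) (Fin.cons ω (fun i => B (η i)) : Fin (r + 1) → F) := by
    intro η
    rw [ExteriorAlgebra.ιMulti_apply, List.ofFn_succ, List.prod_cons]
    simp
  constructor
  · intro hω η
    rw [key]
    apply AlternatingMap.map_linearDependent
    rw [linearIndependent_finCons]
    rintro ⟨hl, hn⟩
    apply hn
    have hle : Submodule.span K (Set.range fun i => B (η i)) ≤ LinearMap.range B := by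
      rw [Submodule.span_le]
      rintro _ ⟨i, rfl⟩
      exact ⟨η i, rfl⟩
    rw [Submodule.eq_of_le_of_finrank_eq hle (by
      rw [finrank_span_eq_card hl, Fintype.card_fin, hr])]
    exact hω
  · intro h
    by_contra hω
    let b := Module.finBasisOfFinrankEq K (LinearMap.range B) hr.symm
    choose η hη using fun i => (b i).2
    have h0 := h η
    rw [key] at h0
    refine wedge_ne_zero_of_linearIndependent ?_ h0
    rw [linearIndependent_finCons]
    constructor
    · simp only [hη]
      exact b.linearIndependent.map' (LinearMap.range B).subtype (Submodule.ker_subtype _)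
    · intro hm
      refine hω (Submodule.span_le.2 ?_ hm)
      rintro _ ⟨i, rfl⟩
      exact ⟨η i, rfl⟩
end

section
/- Uniform Artin–Rees bound for an intersection of ideals: Let R be a Noetherian local ring with maximal ideal m, and let I_1, …, I_s be ideals of R. Then there exists λ ∈ ℕ such that for all k ∈ ℕ, ⋂_{i=1}^s ( m^{k+λ} + I_i ) ⊆ m^k + ⋂_{i=1}^s I_i; i.e., if F ∈ R and F ∈ m^{k+λ} + I_i for each i = 1, …, s, then F ∈ m^k + (I_1 ∩ ⋯ ∩ I_s). -/
/-- Uniform Artin–Rees bound for an intersection of ideals in a Noetherian local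
ring: there is `λ` such that `⋂ᵢ (m^{k+λ} + Iᵢ) ⊆ m^k + ⋂ᵢ Iᵢ` for all `k`. -/
theorem uniform_artinRees_intersection
    (R : Type*) [CommRing R] [IsNoetherianRing R] [IsLocalRing R]
    (s : ℕ) (I : Fin s → Ideal R) :
    ∃ lam : ℕ, ∀ k : ℕ,
      (⨅ i : Fin s, (IsLocalRing.maximalIdeal R ^ (k + lam) + I i)) ≤
        IsLocalRing.maximalIdeal R ^ k + ⨅ i : Fin s, I i := by
  let f : R →ₗ[R] ((i : Fin s) → R ⧸ I i) := LinearMap.pi fun i => (I i).mkQ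
  obtain ⟨c, hc⟩ := Ideal.exists_pow_inf_eq_pow_smul (IsLocalRing.maximalIdeal R)
    (LinearMap.range f)
  refine ⟨c, fun k F hF => ?_⟩
  rw [Submodule.mem_iInf] at hF
  have hmem : f F ∈ (IsLocalRing.maximalIdeal R ^ (k + c) •
      (⊤ : Submodule R ((i : Fin s) → R ⧸ I i))) := by
    rw [← Finset.univ_sum_single (f F)]
    refine Submodule.sum_mem _ fun i _ => ?_
    obtain ⟨a, ha, b, hb, hab⟩ := Submodule.mem_sup.mp (hF i)
    have h1 : f F i = a • (I i).mkQ 1 := by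
      rw [← map_smul, smul_eq_mul, mul_one]
      change (I i).mkQ F = _
      rw [← hab, map_add, add_eq_left]
      exact (Submodule.Quotient.mk_eq_zero _).mpr hb
    rw [h1, Pi.single_smul]
    exact Submodule.smul_mem_smul ha trivial
  have h2 : f F ∈ Submodule.map f (IsLocalRing.maximalIdeal R ^ k • (⊤ : Submodule R R)) := by
    rw [Submodule.map_smul'', Submodule.map_top]
    have h3 := (hc (k + c) (by omega)).le ⟨hmem, LinearMap.mem_range_self f F⟩
    rw [Nat.add_sub_cancel] at h3
    exact Submodule.smul_mono le_rfl inf_le_right h3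
  obtain ⟨g, hg, hgF⟩ := h2
  refine Submodule.mem_sup.mpr ⟨g, by simpa using hg, F - g, ?_, by ring⟩
  rw [Submodule.mem_iInf]
  intro i
  have h4 : (I i).mkQ (F - g) = 0 := by
    rw [map_sub, sub_eq_zero]
    exact (congrFun hgF i).symm
  exact (Submodule.Quotient.mk_eq_zero _).mp h4
end
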